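/- Let f be the marginal normal-compound gamma density with N = 2 levels, parameters c₁ = c₁(n) → 0, fixed c₂ > 1, and scale φ = 1, σ = 1. Then there is a constant C > 0 such that for all k > 0, 1 - ∫_{-k}^{k} f(x) dx ≤ C·c₁(n)/k². In particular, choosing c₁(n) ≲ k_n²·p_n^{-(1+u)} for u > 0 yields 1 - ∫_{-k_n}^{k_n} f(x) dx ≤ p_n^{-(1+u)}. -/

import Mathlib

open MeasureTheory

noncomputable section NCG

def ncgG (x z : ℝ) : ℝ := Real.exp (-(x ^ 2) / (2 * z)) / Real.sqrt (2 * Real.pi * z)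
def ncgP (a y z : ℝ) : ℝ := y ^ a / Real.Gamma a * z ^ (a - 1) * Real.exp (-(z * y))
def ncgQ (b y : ℝ) : ℝ := 1 / Real.Gamma b * y ^ (b - 1) * Real.exp (-y)
def ncgM : Measure ℝ := volume.restrict (Set.Ioi (0:ℝ))

instance : SFinite ncgM := by unfold ncgM; infer_instance

lemma ncgG_eq (x : ℝ) {z : ℝ} (hz : 0 < z) :
    ncgG x z = ProbabilityTheory.gaussianPDFReal 0 z.toNNReal x := by
  simp [ncgG, ProbabilityTheory.gaussianPDFReal, hz.le, div_eq_inv_mul]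

lemma ncgG_nonneg (x z : ℝ) : 0 ≤ ncgG x z := by unfold ncgG; positivity

lemma ncgG_int {z : ℝ} (hz : 0 < z) : Integrable (fun x => ncgG x z) := by
  simp_rw [ncgG_eq _ hz]
  exact ProbabilityTheory.integrable_gaussianPDFReal _ _

lemma ncgG_one {z : ℝ} (hz : 0 < z) : ∫ x, ncgG x z = 1 := by
  simp_rw [ncgG_eq _ hz]
  exact ProbabilityTheory.integral_gaussianPDFReal_eq_one _ (by simpa using hz)

lemma ncgG_sq {z : ℝ} (hz : 0 < z) :
    Integrable (fun x => x ^ 2 * ncgG x z) ∧ ∫ x, x ^ 2 * ncgG x z = z := by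
  have hv : z.toNNReal ≠ 0 := by simpa using hz
  have h1 : ∫ x, x ^ 2 * ncgG x z = z := by
    have h := ProbabilityTheory.variance_id_gaussianReal (μ := 0) (v := z.toNNReal)
    rw [ProbabilityTheory.variance_eq_integral (by fun_prop)] at h
    simp only [id, ProbabilityTheory.integral_id_gaussianReal, sub_zero] at h
    rw [ProbabilityTheory.integral_gaussianReal_eq_integral_smul hv] at h
    simp only [Real.coe_toNNReal _ hz.le, smul_eq_mul] at h
    refine Eq.trans ?_ h
    congr 1; ext x
    rw [ncgG_eq _ hz, mul_comm]
  refine ⟨?_, h1⟩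
  by_contra hn
  rw [integral_undef hn] at h1
  exact hz.ne h1

lemma ncgG_tail {z k : ℝ} (hz : 0 < z) (hk : 0 < k) :
    1 - z / k ^ 2 ≤ ∫ x in Set.Ioc (-k) k, ncgG x z := by
  obtain ⟨h1, h2⟩ := ncgG_sq hz
  have h3 : 1 - z / k ^ 2 = ∫ x, (ncgG x z - (x ^ 2 * ncgG x z) / k ^ 2) := by
    rw [integral_sub (ncgG_int hz) (h1.div_const _), integral_div, h2, ncgG_one hz]
  rw [h3, ← integral_indicator measurableSet_Ioc]
  refine integral_mono ((ncgG_int hz).sub (h1.div_const _))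
    ((ncgG_int hz).indicator measurableSet_Ioc) fun x => ?_
  have hg := ncgG_nonneg x z
  by_cases hx : x ∈ Set.Ioc (-k) k
  · simp only [Set.indicator_of_mem hx]
    have : 0 ≤ x ^ 2 * ncgG x z / k ^ 2 := by positivity
    linarith
  · simp only [Set.indicator_of_notMem hx]
    have hkx : k ^ 2 ≤ x ^ 2 := by
      by_cases h : -k < x
      · have : k < x := by
          by_contra h'
          exact hx ⟨h, not_lt.mp h'⟩
        nlinarith
      · nlinarith
    rw [sub_nonpos, le_div_iff₀ (by positivity)]
    nlinarith

lemma ncgP_nonneg {a y z : ℝ} (ha : 0 < a) (hy : 0 < y) (hz : 0 < z) : 0 ≤ ncgP a y z := by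
  have := Real.Gamma_pos_of_pos ha
  unfold ncgP; positivity

lemma ncgQ_nonneg {b y : ℝ} (hb : 0 < b) (hy : 0 < y) : 0 ≤ ncgQ b y := by
  have := Real.Gamma_pos_of_pos hb
  unfold ncgQ; positivity

lemma ncgP_one {a y : ℝ} (ha : 0 < a) (hy : 0 < y) :
    ∫ z, ncgP a y z ∂ncgM = 1 := by
  have hG := Real.Gamma_pos_of_pos ha
  unfold ncgM ncgP
  simp_rw [mul_assoc, mul_comm _ y]
  rw [integral_const_mul, Real.integral_rpow_mul_exp_neg_mul_Ioi ha hy,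
    Real.div_rpow zero_le_one hy.le, Real.one_rpow]
  have : y ^ a ≠ 0 := (Real.rpow_pos_of_pos hy a).ne'
  field_simp

lemma ncgP_mul {a y : ℝ} (ha : 0 < a) (hy : 0 < y) :
    ∫ z, z * ncgP a y z ∂ncgM = a / y := by
  have hG := Real.Gamma_pos_of_pos ha
  have h : ∀ z ∈ Set.Ioi (0:ℝ), z * ncgP a y z = (a / y) * ncgP (a + 1) y z := by
    intro z hz
    have hz : 0 < z := hz
    unfold ncgP
    rw [Real.Gamma_add_one ha.ne', Real.rpow_add_one hy.ne', add_sub_cancel_right,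
      Real.rpow_sub_one hz.ne']
    field_simp
  unfold ncgM
  rw [setIntegral_congr_fun measurableSet_Ioi h, integral_const_mul]
  have := ncgP_one (a := a + 1) (by positivity) hy
  unfold ncgM at this
  rw [this, mul_one]

lemma ncgQ_one {b : ℝ} (hb : 0 < b) : ∫ y, ncgQ b y ∂ncgM = 1 := by
  have := ncgP_one hb one_pos
  simpa [ncgP, ncgQ] using this

lemma ncgQ_div {b : ℝ} (hb : 1 < b) : ∫ y, ncgQ b y / y ∂ncgM = 1 / (b - 1) := by
  have hb' : 0 < b - 1 := by linarith
  have hG := Real.Gamma_pos_of_pos hb'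
  have h : ∀ y ∈ Set.Ioi (0:ℝ), ncgQ b y / y = (1 / (b - 1)) * ncgQ (b - 1) y := by
    intro z hz
    have hz : 0 < z := hz
    unfold ncgQ
    have hGb : Real.Gamma b = (b - 1) * Real.Gamma (b - 1) := by
      rw [← Real.Gamma_add_one hb'.ne', sub_add_cancel]
    rw [hGb, Real.rpow_sub_one hz.ne' (b - 1)]
    field_simp
  unfold ncgM
  rw [setIntegral_congr_fun measurableSet_Ioi h, integral_const_mul]
  have := ncgQ_one hb'
  unfold ncgM at this
  rw [this, mul_one]

lemma ncgM_ae {p : ℝ → Prop} (h : ∀ z, 0 < z → p z) : ∀ᵐ z ∂ncgM, p z := by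
  unfold ncgM
  filter_upwards [ae_restrict_mem measurableSet_Ioi] with z hz using h z hz

lemma int_of_ne {α : Type*} [MeasurableSpace α] {μ : Measure α} {f : α → ℝ}
    (h : ∫ x, f x ∂μ ≠ 0) : Integrable f μ := by
  by_contra hn
  exact h (integral_undef hn)

lemma ncgMM_ae {p : ℝ × ℝ → Prop} (h : ∀ q : ℝ × ℝ, 0 < q.1 → 0 < q.2 → p q) :
    ∀ᵐ q ∂(ncgM.prod ncgM), p q := by
  unfold ncgM
  rw [Measure.prod_restrict]
  filter_upwards [ae_restrict_mem (measurableSet_Ioi.prod measurableSet_Ioi)] with z hz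
    using h z hz.1 hz.2

def ncgW (a b : ℝ) (q : ℝ × ℝ) : ℝ := ncgP a q.1 q.2 * ncgQ b q.1

lemma ncgW_meas (a b : ℝ) : Measurable (ncgW a b) := by
  unfold ncgW ncgP ncgQ; fun_prop

lemma ncgW_nonneg {a b : ℝ} (ha : 0 < a) (hb : 0 < b) (q : ℝ × ℝ) (h1 : 0 < q.1)
    (h2 : 0 < q.2) : 0 ≤ ncgW a b q :=
  mul_nonneg (ncgP_nonneg ha h1 h2) (ncgQ_nonneg hb h1)

lemma ncgW_one {a b : ℝ} (ha : 0 < a) (hb : 0 < b) :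
    Integrable (ncgW a b) (ncgM.prod ncgM) ∧ ∫ q, ncgW a b q ∂(ncgM.prod ncgM) = 1 := by
  have hi : Integrable (ncgW a b) (ncgM.prod ncgM) := by
    rw [integrable_prod_iff (ncgW_meas a b).aestronglyMeasurable]
    constructor
    · refine ncgM_ae fun y hy => ?_
      have h0 : Integrable (ncgP a y) ncgM := int_of_ne (by rw [ncgP_one ha hy]; simp)
      exact h0.mul_const (ncgQ b y)
    · refine (int_of_ne (by rw [ncgQ_one hb]; simp) : Integrable (ncgQ b) ncgM).congr ?_
      refine ncgM_ae fun y hy => ?_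
      have : ∫ z, ‖ncgW a b (y, z)‖ ∂ncgM = ∫ z, ncgP a y z * ncgQ b y ∂ncgM :=
        integral_congr_ae (ncgM_ae fun z hz => Real.norm_of_nonneg (ncgW_nonneg ha hb _ hy hz))
      dsimp only
      rw [this, integral_mul_const, ncgP_one ha hy, one_mul]
  refine ⟨hi, ?_⟩
  rw [integral_prod _ hi, ← ncgQ_one hb]
  refine integral_congr_ae (ncgM_ae fun y hy => ?_)
  simp only [ncgW]
  rw [integral_mul_const, ncgP_one ha hy, one_mul]

lemma ncgW_mul {a b : ℝ} (ha : 0 < a) (hb : 1 < b) :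
    Integrable (fun q => q.2 * ncgW a b q) (ncgM.prod ncgM) ∧
      ∫ q, q.2 * ncgW a b q ∂(ncgM.prod ncgM) = a / (b - 1) := by
  have hb0 : 0 < b := by linarith
  have hb1 : 0 < b - 1 := by linarith
  have key : ∀ y, 0 < y → ∫ z, z * ncgW a b (y, z) ∂ncgM = a * (ncgQ b y / y) := by
    intro y hy
    simp only [ncgW, ← mul_assoc]
    rw [integral_mul_const, ncgP_mul ha hy]
    ring
  have hi : Integrable (fun q => q.2 * ncgW a b q) (ncgM.prod ncgM) := by
    have hm : Measurable (fun q : ℝ × ℝ => q.2 * ncgW a b q) :=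
      measurable_snd.mul (ncgW_meas a b)
    rw [integrable_prod_iff hm.aestronglyMeasurable]
    constructor
    · refine ncgM_ae fun y hy => ?_
      simp only [ncgW, ← mul_assoc]
      exact (int_of_ne (by rw [ncgP_mul ha hy]; positivity)).mul_const _
    · have h0 : Integrable (fun y => ncgQ b y / y) ncgM :=
        int_of_ne (by rw [ncgQ_div hb]; positivity)
      refine (h0.const_mul a).congr ?_
      refine ncgM_ae fun y hy => ?_
      dsimp only
      rw [← key y hy]
      exact integral_congr_ae (ncgM_ae fun z hz => (Real.norm_of_nonneg
        (mul_nonneg hz.le (ncgW_nonneg ha hb0 (y, z) hy hz))).symm)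
  refine ⟨hi, ?_⟩
  rw [integral_prod _ hi, integral_congr_ae (ncgM_ae key), integral_const_mul, ncgQ_div hb]
  ring

lemma ncg_main {a b k : ℝ} (ha : 0 < a) (hb : 1 < b) (hk : 0 < k) :
    1 - ∫ x in (-k)..k, (∫ y, ∫ z, ncgG x z * ncgP a y z * ncgQ b y ∂ncgM ∂ncgM)
      ≤ 1 / (b - 1) * a / k ^ 2 := by
  have hb0 : 0 < b := by linarith
  obtain ⟨w1, w2⟩ := ncgW_one ha hb0
  obtain ⟨m1, m2⟩ := ncgW_mul ha hb
  have hi : Integrable (fun r : ℝ × (ℝ × ℝ) => ncgG r.1 r.2.2 * ncgW a b r.2)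
      (volume.prod (ncgM.prod ncgM)) := by
    have hm : Measurable (fun r : ℝ × (ℝ × ℝ) => ncgG r.1 r.2.2 * ncgW a b r.2) := by
      refine Measurable.mul ?_ ((ncgW_meas a b).comp measurable_snd)
      unfold ncgG; fun_prop
    rw [integrable_prod_iff' hm.aestronglyMeasurable]
    constructor
    · exact ncgMM_ae fun q _ h2 => (ncgG_int h2).mul_const (ncgW a b q)
    · refine w1.congr (ncgMM_ae fun q h1 h2 => ?_)
      have : ∀ x, ‖ncgG x q.2 * ncgW a b q‖ = ncgG x q.2 * ncgW a b q := fun x =>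
        Real.norm_of_nonneg (mul_nonneg (ncgG_nonneg _ _) (ncgW_nonneg ha hb0 q h1 h2))
      simp only [this]
      rw [integral_mul_const, ncgG_one h2, one_mul]
  have hi' : Integrable (fun r : ℝ × (ℝ × ℝ) => ncgG r.1 r.2.2 * ncgW a b r.2)
      ((volume.restrict (Set.Ioc (-k) k)).prod (ncgM.prod ncgM)) := by
    refine hi.mono_measure ?_
    exact Measure.prod_mono Measure.restrict_le_self le_rfl
  have e1 : ∫ x in (-k)..k, (∫ y, ∫ z, ncgG x z * ncgP a y z * ncgQ b y ∂ncgM ∂ncgM)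
      = ∫ x in Set.Ioc (-k) k, ∫ q, ncgG x q.2 * ncgW a b q ∂(ncgM.prod ncgM) := by
    rw [intervalIntegral.integral_of_le (by linarith)]
    refine integral_congr_ae ?_
    filter_upwards [hi'.prod_right_ae] with x hx
    rw [integral_prod _ hx]
    simp only [ncgW, mul_assoc]
  rw [e1, integral_integral_swap hi']
  have e2 : 1 - 1 / (b - 1) * a / k ^ 2
      = ∫ q, (ncgW a b q - q.2 * ncgW a b q / k ^ 2) ∂(ncgM.prod ncgM) := by
    rw [integral_sub w1 (m1.div_const _), integral_div, w2, m2]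
    ring
  have e3 : ∫ q, (ncgW a b q - q.2 * ncgW a b q / k ^ 2) ∂(ncgM.prod ncgM)
      ≤ ∫ q, (∫ x in Set.Ioc (-k) k, ncgG x q.2 * ncgW a b q) ∂(ncgM.prod ncgM) := by
    refine integral_mono_ae (w1.sub (m1.div_const _)) hi'.integral_prod_right
      (ncgMM_ae fun q h1 h2 => ?_)
    dsimp only
    rw [integral_mul_const]
    have := mul_le_mul_of_nonneg_right (ncgG_tail h2 hk) (ncgW_nonneg ha hb0 q h1 h2)
    refine le_trans (le_of_eq ?_) this
    ring
  linarith

end NCG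

/-- Tail bound for the two-level normal-compound gamma marginal with `c₁(n) → 0`,
fixed `c₂ > 1`, `φ = σ = 1`: there is `C > 0` with
`1 - ∫_{-k}^k f_n ≤ C c₁(n)/k²` for all `k > 0` (all large `n`); in particular, if
`c₁(n) ≤ k_n² p_n^{-(1+u)}/C` then `1 - ∫_{-k_n}^{k_n} f_n ≤ p_n^{-(1+u)}`. -/
theorem stmt16 (c : ℕ → ℝ) (hc : ∀ n, 0 < c n)
    (hlim : Filter.Tendsto c Filter.atTop (nhds 0)) (c₂ : ℝ) (hc₂ : 1 < c₂)
    (kn pn : ℕ → ℝ) (hkn : ∀ n, 0 < kn n) (hpn : ∀ n, 1 < pn n) (u : ℝ) (hu : 0 < u) :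
    let f : ℕ → ℝ → ℝ := fun n x =>
      ∫ z₂ in Set.Ioi (0:ℝ), ∫ z₁ in Set.Ioi (0:ℝ),
        Real.exp (-(x ^ 2) / (2 * z₁)) / Real.sqrt (2 * Real.pi * z₁) *
          (z₂ ^ c n / Real.Gamma (c n) * z₁ ^ (c n - 1) * Real.exp (-(z₁ * z₂))) *
          (1 / Real.Gamma c₂ * z₂ ^ (c₂ - 1) * Real.exp (-z₂))
    ∃ C > 0, ∃ N : ℕ,
      (∀ n ≥ N, ∀ k > 0, 1 - ∫ x in (-k)..k, f n x ≤ C * c n / k ^ 2) ∧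
      ((∀ n, c n ≤ kn n ^ 2 * pn n ^ (-(1 + u)) / C) →
        ∀ n ≥ N, 1 - ∫ x in (-(kn n))..(kn n), f n x ≤ pn n ^ (-(1 + u))) := by
  intro f
  have hb : 0 < c₂ - 1 := by linarith
  have key : ∀ n, ∀ k > 0, 1 - ∫ x in (-k)..k, f n x ≤ 1 / (c₂ - 1) * c n / k ^ 2 :=
    fun n k hk => ncg_main (hc n) hc₂ hk
  refine ⟨1 / (c₂ - 1), by positivity, 0, fun n _ k hk => key n k hk, fun h n _ => ?_⟩
  refine (key n _ (hkn n)).trans ?_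
  have hk := hkn n
  have h1 := h n
  rw [le_div_iff₀ (by positivity)] at h1
  rw [div_le_iff₀ (by positivity)]
  linarith
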